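/- Let S be a densely defined symmetric operator on a complex Hilbert space V, let (H₋, H₊, Γ₋, Γ₊) be a boundary quadruple for S, and assume H₊ and H₋ are unitarily isomorphic. Let T be an operator on V with S ⊆ T. Then T is selfadjoint if and only if there exists a unitary operator Φ: H₊ → H₋ such that D(T) = {w ∈ D(S*) : Φ Γ₊ w = Γ₋ w} and Tw = S*w for all w ∈ D(T). -/

import Mathlib

variable {V : Type*} [NormedAddCommGroup V] [InnerProductSpace ℂ V] [CompleteSpace V]

/-- An operator `S` on a complex Hilbert space is *symmetric* if `⟪Su, v⟫ = ⟪u, Sv⟫` for all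
`u, v ∈ D(S)`. -/
def SymmetricOp (S : V →ₗ.[ℂ] V) : Prop :=
  ∀ u v : S.domain, @inner ℂ _ _ (S u) (v : V) = @inner ℂ _ _ (u : V) (S v)

/-- A *boundary quadruple* `(H₋, H₊, Γ₋, Γ₊)` for a densely defined symmetric operator `S`
consists of complex pre-Hilbert spaces `H₋, H₊` and surjective linear maps
`Γ₋ : D(S*) → H₋`, `Γ₊ : D(S*) → H₊` such that
`⟪S*u, v⟫ - ⟪u, S*v⟫ = i(⟪Γ₋u, Γ₋v⟫ - ⟪Γ₊u, Γ₊v⟫)` for all `u, v ∈ D(S*)` and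
`ker Γ₊ + ker Γ₋ = D(S*)`. -/
def IsBoundaryQuadrupleSymm (S : V →ₗ.[ℂ] V) {Hm Hp : Type*}
    [NormedAddCommGroup Hm] [InnerProductSpace ℂ Hm]
    [NormedAddCommGroup Hp] [InnerProductSpace ℂ Hp]
    (Γm : S.adjoint.domain →ₗ[ℂ] Hm) (Γp : S.adjoint.domain →ₗ[ℂ] Hp) : Prop :=
  Function.Surjective Γm ∧ Function.Surjective Γp ∧
    (∀ u v : S.adjoint.domain,
      @inner ℂ _ _ (S.adjoint u) (v : V) - @inner ℂ _ _ (u : V) (S.adjoint v) =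
        Complex.I * (@inner ℂ _ _ (Γm u) (Γm v) - @inner ℂ _ _ (Γp u) (Γp v))) ∧
    LinearMap.ker Γp ⊔ LinearMap.ker Γm = ⊤

open scoped ComplexConjugate InnerProductSpace

theorem SymmetricOp.le_adjoint {S : V →ₗ.[ℂ] V} (hsym : SymmetricOp S)
    (hdense : Dense (S.domain : Set V)) : S ≤ S.adjoint :=
  LinearPMap.IsFormalAdjoint.le_adjoint hdense fun u v => hsym u v

/-- A component of a boundary map vanishes on the domain of the original operator. -/
theorem boundaryMap_eq_zero_of_mem_domain {S : V →ₗ.[ℂ] V}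
    (hdense : Dense (S.domain : Set V)) (hS : S ≤ S.adjoint) {H H' : Type*}
    [NormedAddCommGroup H] [InnerProductSpace ℂ H]
    [NormedAddCommGroup H'] [InnerProductSpace ℂ H']
    {Γ : S.adjoint.domain →ₗ[ℂ] H} {Γ' : S.adjoint.domain →ₗ[ℂ] H'} {c : ℂ} (hc : c ≠ 0)
    (hform : ∀ u v : S.adjoint.domain,
      ⟪S.adjoint u, (v : V)⟫_ℂ - ⟪(u : V), S.adjoint v⟫_ℂ =
        c * (⟪Γ u, Γ v⟫_ℂ - ⟪Γ' u, Γ' v⟫_ℂ))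
    (hsurj : ∀ x, ∃ u, Γ u = x ∧ Γ' u = 0)
    (s : S.adjoint.domain) (hs : (s : V) ∈ S.domain) : Γ s = 0 := by
  obtain ⟨v, hv, hv'⟩ := hsurj (Γ s)
  have h := hform v s
  have hSs : S ⟨s, hs⟩ = S.adjoint s := hS.2 rfl
  have hadj := LinearPMap.adjoint_isFormalAdjoint hdense v ⟨s, hs⟩
  rw [hSs] at hadj
  simp only [hadj, sub_self, hv, hv', inner_zero_left, sub_zero] at h
  simpa [hc] using h.symm

/-- The graph of the adjoint, as a subspace of the Hilbert sum `V ⊕ V`. -/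
noncomputable def adjointGraphL2 (S : V →ₗ.[ℂ] V) : Submodule ℂ (WithLp 2 (V × V)) :=
  S.adjoint.graph.comap (WithLp.linearEquiv 2 ℂ (V × V)).toLinearMap

theorem mem_adjointGraphL2 (S : V →ₗ.[ℂ] V) (k : WithLp 2 (V × V)) :
    k ∈ adjointGraphL2 S ↔ ∃ u : S.adjoint.domain, (u : V) = k.fst ∧ S.adjoint u = k.snd :=
  LinearPMap.mem_graph_iff _

theorem completeSpace_adjointGraphL2 {S : V →ₗ.[ℂ] V} (hdense : Dense (S.domain : Set V)) :
    CompleteSpace (adjointGraphL2 S) := by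
  have h : IsClosed (adjointGraphL2 S : Set (WithLp 2 (V × V))) :=
    (LinearPMap.adjoint_isClosed hdense).preimage (WithLp.prod_continuous_ofLp 2 V V)
  exact h.completeSpace_coe

/-- The projection of the graph of the adjoint onto the domain. -/
noncomputable def adjointGraphL2Fst (S : V →ₗ.[ℂ] V) :
    adjointGraphL2 S →ₗ[ℂ] S.adjoint.domain where
  toFun k := ⟨k.1.fst, LinearPMap.mem_domain_of_mem_graph k.2⟩
  map_add' _ _ := rfl
  map_smul' _ _ := rfl

theorem adjoint_adjointGraphL2Fst (S : V →ₗ.[ℂ] V) (k : adjointGraphL2 S) :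
    S.adjoint (adjointGraphL2Fst S k) = k.1.snd := by
  obtain ⟨u, hu, hu'⟩ := (mem_adjointGraphL2 S k).1 k.2
  rw [← hu']
  congr 1
  exact Subtype.ext hu.symm

theorem exists_adjointGraphL2Fst_eq (S : V →ₗ.[ℂ] V) (u : S.adjoint.domain) :
    ∃ k, adjointGraphL2Fst S k = u :=
  ⟨⟨WithLp.toLp 2 ((u : V), S.adjoint u), (mem_adjointGraphL2 S _).2 ⟨u, rfl, rfl⟩⟩, rfl⟩

/-- A boundary map, composed with the embedding into the completion of the boundary space, is
continuous for the graph norm. -/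
theorem continuous_boundaryMap {S : V →ₗ.[ℂ] V} (hdense : Dense (S.domain : Set V))
    {H H' : Type*}
    [NormedAddCommGroup H] [InnerProductSpace ℂ H]
    [NormedAddCommGroup H'] [InnerProductSpace ℂ H']
    {Γ : S.adjoint.domain →ₗ[ℂ] H} {Γ' : S.adjoint.domain →ₗ[ℂ] H'} {c : ℂ} (hc : c ≠ 0)
    (hform : ∀ u v : S.adjoint.domain,
      ⟪S.adjoint u, (v : V)⟫_ℂ - ⟪(u : V), S.adjoint v⟫_ℂ =
        c * (⟪Γ u, Γ v⟫_ℂ - ⟪Γ' u, Γ' v⟫_ℂ))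
    (hsurj : ∀ x, ∃ u, Γ u = x ∧ Γ' u = 0) :
    Continuous ((UniformSpace.Completion.toComplₗᵢ (𝕜 := ℂ) (E := H)).toLinearMap ∘ₗ Γ ∘ₗ
      adjointGraphL2Fst S) := by
  have := completeSpace_adjointGraphL2 hdense
  refine LinearMap.continuous_of_seq_closed_graph _ fun k x y hk hy => ?_
  refine DenseRange.eq_of_inner_left ℂ UniformSpace.Completion.denseRange_coe fun z => ?_
  obtain ⟨v, rfl, hv'⟩ := hsurj z
  have key (k : adjointGraphL2 S) : ⟪(Γ (adjointGraphL2Fst S k) : UniformSpace.Completion H),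
      (Γ v : UniformSpace.Completion H)⟫_ℂ =
        c⁻¹ * (⟪k.1.snd, (v : V)⟫_ℂ - ⟪k.1.fst, S.adjoint v⟫_ℂ) := by
    have h := hform (adjointGraphL2Fst S k) v
    rw [hv', inner_zero_right, sub_zero, adjoint_adjointGraphL2Fst] at h
    rw [UniformSpace.Completion.inner_coe, eq_inv_mul_iff_mul_eq₀ hc, ← h]
    rfl
  have hcont : Continuous fun k : adjointGraphL2 S =>
      c⁻¹ * (⟪k.1.snd, (v : V)⟫_ℂ - ⟪k.1.fst, S.adjoint v⟫_ℂ) := by fun_prop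
  refine tendsto_nhds_unique (hy.inner tendsto_const_nhds) ?_
  have hlim := (hcont.tendsto x).comp hk
  simp only [← key] at hlim
  exact hlim

/-- The boundary spaces of a densely defined symmetric operator are automatically complete. -/
theorem completeSpace_of_boundary_form {S : V →ₗ.[ℂ] V} (hdense : Dense (S.domain : Set V))
    (hS : S ≤ S.adjoint) {H H' : Type*}
    [NormedAddCommGroup H] [InnerProductSpace ℂ H]
    [NormedAddCommGroup H'] [InnerProductSpace ℂ H']
    {Γ : S.adjoint.domain →ₗ[ℂ] H} {Γ' : S.adjoint.domain →ₗ[ℂ] H'} {c : ℂ} (hc : c ≠ 0)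
    (hform : ∀ u v : S.adjoint.domain,
      ⟪S.adjoint u, (v : V)⟫_ℂ - ⟪(u : V), S.adjoint v⟫_ℂ =
        c * (⟪Γ u, Γ v⟫_ℂ - ⟪Γ' u, Γ' v⟫_ℂ))
    (hsurj : ∀ x, ∃ u, Γ u = x ∧ Γ' u = 0) : CompleteSpace H := by
  have := completeSpace_adjointGraphL2 hdense
  refine ((UniformSpace.Completion.isUniformInducing_coe H).completeSpace_congr
    fun y => ?_).2 inferInstance
  let A : adjointGraphL2 S →L[ℂ] UniformSpace.Completion H :=
    ⟨_, continuous_boundaryMap hdense hc hform hsurj⟩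
  have hA (k) : A k = Γ (adjointGraphL2Fst S k) := rfl
  obtain ⟨k₀, hk₀⟩ : ∃ k₀, ∀ k, ⟪k₀, k⟫_ℂ = ⟪y, A k⟫_ℂ :=
    ⟨(InnerProductSpace.toDual ℂ _).symm (innerSL ℂ y ∘L A), fun k => by simp⟩
  have hk₀' (v : S.adjoint.domain) : ⟪k₀.1.fst, (v : V)⟫_ℂ + ⟪k₀.1.snd, S.adjoint v⟫_ℂ =
      ⟪y, (Γ v : UniformSpace.Completion H)⟫_ℂ := by
    obtain ⟨k, rfl⟩ := exists_adjointGraphL2Fst_eq S v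
    rw [← hA, ← hk₀, Submodule.coe_inner, WithLp.prod_inner_apply, adjoint_adjointGraphL2Fst]
    rfl
  have hadj (s : S.domain) : ⟪-k₀.1.fst, (s : V)⟫_ℂ = ⟪k₀.1.snd, S s⟫_ℂ := by
    have hs := hk₀' ⟨s, hS.1 s.2⟩
    rw [boundaryMap_eq_zero_of_mem_domain hdense hS hc hform hsurj _ s.2,
      UniformSpace.Completion.coe_zero, inner_zero_right,
      ← hS.2 (x := s) (y := ⟨s, hS.1 s.2⟩) rfl] at hs
    rw [inner_neg_left, neg_eq_iff_add_eq_zero, hs]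
  let a : S.adjoint.domain := ⟨k₀.1.snd, LinearPMap.mem_adjoint_domain_of_exists _ ⟨_, hadj⟩⟩
  have ha : S.adjoint a = -k₀.1.fst := LinearPMap.adjoint_apply_eq hdense a hadj
  refine ⟨-(conj c • Γ a),
    DenseRange.eq_of_inner_left ℂ UniformSpace.Completion.denseRange_coe fun z => ?_⟩
  obtain ⟨v, rfl, hv'⟩ := hsurj z
  have h := hform a v
  rw [ha, hv', inner_zero_right, sub_zero, inner_neg_left] at h
  rw [← hk₀', UniformSpace.Completion.inner_coe, inner_neg_left, inner_smul_left,
    Complex.conj_conj, ← h]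
  ring

theorem norm_eq_norm_of_inner_self_eq {H H' : Type*}
    [NormedAddCommGroup H] [InnerProductSpace ℂ H]
    [NormedAddCommGroup H'] [InnerProductSpace ℂ H'] {x : H} {y : H'}
    (h : ⟪y, y⟫_ℂ = ⟪x, x⟫_ℂ) : ‖y‖ = ‖x‖ := by
  rw [inner_self_eq_norm_sq_to_K, inner_self_eq_norm_sq_to_K] at h
  norm_cast at h
  exact (sq_eq_sq₀ (norm_nonneg _) (norm_nonneg _)).1 h

/-- A subspace of `H ⊕ H'` which is its own orthogonal complement with respect to the indefinite
form `⟪x, x'⟫ - ⟪y, y'⟫` projects onto `H`. -/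
theorem exists_mem_of_hypermaximal_neutral {H H' : Type*}
    [NormedAddCommGroup H] [InnerProductSpace ℂ H] [CompleteSpace H]
    [NormedAddCommGroup H'] [InnerProductSpace ℂ H'] [CompleteSpace H']
    (G : Submodule ℂ (H × H'))
    (hG : ∀ p, p ∈ G ↔ ∀ q ∈ G, ⟪p.1, q.1⟫_ℂ = ⟪p.2, q.2⟫_ℂ) (x : H) : ∃ y, (x, y) ∈ G := by
  have hnorm (p) (hp : p ∈ G) : ‖p.2‖ = ‖p.1‖ :=
    norm_eq_norm_of_inner_self_eq ((hG p).1 hp p hp).symm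
  have hclosed : IsClosed (G : Set (H × H')) := by
    have : (G : Set (H × H')) = ⋂ q ∈ G, {p | ⟪p.1, q.1⟫_ℂ = ⟪p.2, q.2⟫_ℂ} := by
      ext p
      simpa using hG p
    rw [this]
    exact isClosed_biInter fun q _ => isClosed_eq (by fun_prop) (by fun_prop)
  have := hclosed.completeSpace_coe
  let f : G →ₗᵢ[ℂ] H :=
    ⟨LinearMap.fst ℂ H H' ∘ₗ G.subtype, fun p => by
      simp [Prod.norm_def, hnorm p.1 p.2]⟩
  have hrange : IsClosed (LinearMap.range f.toLinearMap : Set H) :=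
    f.isometry.isClosedEmbedding.isClosed_range
  have := hrange.completeSpace_coe
  have htop : LinearMap.range f.toLinearMap = ⊤ := by
    rw [← Submodule.orthogonal_eq_bot_iff, Submodule.eq_bot_iff]
    intro z hz
    have hmem : (z, (0 : H')) ∈ G := by
      rw [hG]
      intro q hq
      rw [inner_zero_left]
      exact (Submodule.mem_orthogonal' _ z).1 hz q.1 ⟨⟨q, hq⟩, rfl⟩
    simpa using (hnorm _ hmem).symm
  obtain ⟨p, hp⟩ := LinearMap.range_eq_top.1 htop x
  exact ⟨p.1.2, by rw [← hp]; exact p.2⟩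

/-- A subspace of `H ⊕ H'` which is its own orthogonal complement with respect to the indefinite
form `⟪x, x'⟫ - ⟪y, y'⟫` is the graph of a unitary operator. -/
theorem exists_unitary_of_hypermaximal_neutral {H H' : Type*}
    [NormedAddCommGroup H] [InnerProductSpace ℂ H] [CompleteSpace H]
    [NormedAddCommGroup H'] [InnerProductSpace ℂ H'] [CompleteSpace H']
    (G : Submodule ℂ (H × H'))
    (hG : ∀ p, p ∈ G ↔ ∀ q ∈ G, ⟪p.1, q.1⟫_ℂ = ⟪p.2, q.2⟫_ℂ) :
    ∃ Φ : H →ₗ[ℂ] H', (∀ x, ‖Φ x‖ = ‖x‖) ∧ Function.Surjective Φ ∧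
      ∀ p, p ∈ G ↔ Φ p.1 = p.2 := by
  have hnorm (p) (hp : p ∈ G) : ‖p.2‖ = ‖p.1‖ :=
    norm_eq_norm_of_inner_self_eq ((hG p).1 hp p hp).symm
  have hunique {x : H} {y y' : H'} (h : (x, y) ∈ G) (h' : (x, y') ∈ G) : y = y' := by
    have := hnorm _ (G.sub_mem h h')
    simpa [sub_eq_zero] using this
  choose f hf using exists_mem_of_hypermaximal_neutral G hG
  let Φ : H →ₗ[ℂ] H' :=
    { toFun := f
      map_add' := fun x y => hunique (hf _) (G.add_mem (hf x) (hf y))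
      map_smul' := fun a x => hunique (hf _) (G.smul_mem a (hf x)) }
  refine ⟨Φ, fun x => hnorm _ (hf x), fun y => ?_, fun p => ⟨fun hp => hunique (hf _) hp, ?_⟩⟩
  · obtain ⟨x, hx⟩ := exists_mem_of_hypermaximal_neutral
      (G.comap (LinearEquiv.prodComm ℂ H' H).toLinearMap) (fun p => by
        simpa [eq_comm, and_comm] using ⟨fun h a b => (hG p.swap).1 h (b, a),
          fun h => (hG p.swap).2 fun q => h q.2 q.1⟩) y
    exact ⟨x, hunique (hf x) hx⟩
  · intro hp
    have := hf p.1
    rwa [show f p.1 = p.2 from hp] at this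

theorem adjoint_le_adjoint {S T : V →ₗ.[ℂ] V} (hdense : Dense (S.domain : Set V)) (hST : S ≤ T) :
    T.adjoint ≤ S.adjoint :=
  LinearPMap.IsFormalAdjoint.le_adjoint hdense fun s w => by
    rw [hST.2 (x := s) (y := ⟨s, hST.1 s.2⟩) rfl]
    exact (LinearPMap.adjoint_isFormalAdjoint (hdense.mono hST.1)).symm ⟨s, hST.1 s.2⟩ w

/-- For `S ⊆ T ⊆ S*`, the domain of `T*` is the orthogonal complement of the domain of `T` with
respect to the boundary form. -/
theorem mem_adjoint_domain_iff_of_boundary_form {S T : V →ₗ.[ℂ] V}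
    (hdense : Dense (S.domain : Set V)) (hTdense : Dense (T.domain : Set V)) (hST : S ≤ T)
    (hTS : T ≤ S.adjoint) {Hm Hp : Type*}
    [NormedAddCommGroup Hm] [InnerProductSpace ℂ Hm]
    [NormedAddCommGroup Hp] [InnerProductSpace ℂ Hp]
    {Γm : S.adjoint.domain →ₗ[ℂ] Hm} {Γp : S.adjoint.domain →ₗ[ℂ] Hp}
    (hform : ∀ u v : S.adjoint.domain,
      ⟪S.adjoint u, (v : V)⟫_ℂ - ⟪(u : V), S.adjoint v⟫_ℂ =
        Complex.I * (⟪Γm u, Γm v⟫_ℂ - ⟪Γp u, Γp v⟫_ℂ)) (w : S.adjoint.domain) :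
    (w : V) ∈ T.adjoint.domain ↔
      ∀ v : S.adjoint.domain, (v : V) ∈ T.domain → ⟪Γp w, Γp v⟫_ℂ = ⟪Γm w, Γm v⟫_ℂ := by
  have hform_zero (v : S.adjoint.domain) : ⟪Γp w, Γp v⟫_ℂ = ⟪Γm w, Γm v⟫_ℂ ↔
      ⟪S.adjoint w, (v : V)⟫_ℂ = ⟪(w : V), S.adjoint v⟫_ℂ := by
    rw [← sub_eq_zero (a := ⟪S.adjoint w, (v : V)⟫_ℂ), hform, mul_eq_zero,
      or_iff_right Complex.I_ne_zero, sub_eq_zero, eq_comm]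
  simp only [hform_zero]
  constructor
  · intro hw v hv
    have h := LinearPMap.adjoint_isFormalAdjoint hTdense ⟨w, hw⟩ ⟨v, hv⟩
    rwa [(adjoint_le_adjoint hdense hST).2 (y := w) rfl, hTS.2 (y := v) rfl] at h
  · refine fun h => LinearPMap.mem_adjoint_domain_of_exists _ ⟨S.adjoint w, fun t => ?_⟩
    rw [hTS.2 (y := ⟨t, hTS.1 t.2⟩) rfl]
    exact h ⟨t, hTS.1 t.2⟩ t.2

/-- Two surjective linear maps whose kernels span the space are jointly surjective. -/
theorem exists_boundary_values {R M N P : Type*} [Ring R] [AddCommGroup M] [Module R M]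
    [AddCommGroup N] [Module R N] [AddCommGroup P] [Module R P] {f : M →ₗ[R] N} {g : M →ₗ[R] P}
    (hf : Function.Surjective f) (hg : Function.Surjective g)
    (hker : LinearMap.ker g ⊔ LinearMap.ker f = ⊤) (x : N) (y : P) :
    ∃ w, f w = x ∧ g w = y := by
  obtain ⟨u, rfl⟩ := hf x
  obtain ⟨v, rfl⟩ := hg y
  obtain ⟨a, ha, b, hb, hab⟩ := Submodule.mem_sup.1 (hker ▸ Submodule.mem_top : u - v ∈ _)
  rw [LinearMap.mem_ker] at ha hb
  have hw : v + a = u - b := by rw [add_comm, eq_sub_iff_add_eq, add_right_comm, hab]; abel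
  refine ⟨v + a, ?_, ?_⟩
  · rw [hw, map_sub, hb, sub_zero]
  · rw [map_add, ha, add_zero]

/-- Let `S` be a densely defined symmetric operator on a complex Hilbert space with boundary
quadruple `(H₋, H₊, Γ₋, Γ₊)` such that `H₊` and `H₋` are unitarily isomorphic, and let `T`
be an operator with `S ⊆ T`.  Then `T` is selfadjoint if and only if there is a unitary
operator `Φ : H₊ → H₋` (a surjective linear isometry) such that
`D(T) = {w ∈ D(S*) : Φ Γ₊ w = Γ₋ w}` and `Tw = S*w` for all `w ∈ D(T)`. -/
theorem selfAdjoint_extension_iff_exists_unitary {Hm Hp : Type*}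
    [NormedAddCommGroup Hm] [InnerProductSpace ℂ Hm]
    [NormedAddCommGroup Hp] [InnerProductSpace ℂ Hp]
    (S : V →ₗ.[ℂ] V) (hdense : Dense (S.domain : Set V)) (hsym : SymmetricOp S)
    (Γm : S.adjoint.domain →ₗ[ℂ] Hm) (Γp : S.adjoint.domain →ₗ[ℂ] Hp)
    (hq : IsBoundaryQuadrupleSymm S Γm Γp)
    (hiso : Nonempty (Hp ≃ₗᵢ[ℂ] Hm))
    (T : V →ₗ.[ℂ] V) (hST : S ≤ T) :
    (Dense (T.domain : Set V) ∧ T.adjoint = T) ↔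
      ∃ Φ : Hp →ₗ[ℂ] Hm, (∀ x, ‖Φ x‖ = ‖x‖) ∧ Function.Surjective Φ ∧
        (∀ x : V, x ∈ T.domain ↔
          ∃ hx : x ∈ S.adjoint.domain, Φ (Γp ⟨x, hx⟩) = Γm ⟨x, hx⟩) ∧
        ∀ (x : V) (hxT : x ∈ T.domain) (hxA : x ∈ S.adjoint.domain),
          T ⟨x, hxT⟩ = S.adjoint ⟨x, hxA⟩ := by
  obtain ⟨hΓm, hΓp, hform, hker⟩ := hq
  have hjoint := exists_boundary_values hΓm hΓp hker
  have hS := hsym.le_adjoint hdense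
  constructor
  · rintro ⟨hTdense, hT⟩
    have : CompleteSpace Hm := completeSpace_of_boundary_form hdense hS (Γ := Γm) (Γ' := Γp)
      Complex.I_ne_zero hform fun x => (hjoint x 0)
    have : CompleteSpace Hp := completeSpace_of_boundary_form hdense hS (Γ := Γp) (Γ' := Γm)
      (neg_ne_zero.2 Complex.I_ne_zero) (fun u v => by rw [hform]; ring)
      fun x => (hjoint 0 x).imp fun _ h => h.symm
    have hTform : T.IsFormalAdjoint T := by
      have := LinearPMap.adjoint_isFormalAdjoint hTdense
      rwa [hT] at this
    have hTS : T ≤ S.adjoint := LinearPMap.IsFormalAdjoint.le_adjoint hdense fun s t => by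
      rw [← hTform ⟨s, hST.1 s.2⟩ t, hST.2 (x := s) (y := ⟨s, hST.1 s.2⟩) rfl]
    have hmem := mem_adjoint_domain_iff_of_boundary_form hdense hTdense hST hTS hform
    rw [hT] at hmem
    let G : Submodule ℂ (Hp × Hm) :=
      (T.domain.comap S.adjoint.domain.subtype).map (Γp.prod Γm)
    have hmemG (w : S.adjoint.domain) : (w : V) ∈ T.domain ↔
        ∀ q ∈ G, ⟪(Γp w, Γm w).1, q.1⟫_ℂ = ⟪(Γp w, Γm w).2, q.2⟫_ℂ := by
      rw [hmem]
      constructor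
      · rintro h _ ⟨v, hv, rfl⟩
        exact h v hv
      · exact fun h v hv => h _ ⟨v, hv, rfl⟩
    have hG (w : S.adjoint.domain) : (w : V) ∈ T.domain ↔ (Γp w, Γm w) ∈ G := by
      refine ⟨fun hw => ⟨w, hw, rfl⟩, ?_⟩
      rintro ⟨v, hv, hvw⟩
      rw [hmemG, ← hvw]
      exact (hmemG v).1 hv
    obtain ⟨Φ, hΦ, hΦs, hΦG⟩ := exists_unitary_of_hypermaximal_neutral G (by
      rintro ⟨x, y⟩
      obtain ⟨w, rfl, rfl⟩ := hjoint y x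
      rw [← hG, hmemG])
    refine ⟨Φ, hΦ, hΦs, fun x => ⟨fun hx => ⟨hTS.1 hx, ?_⟩, ?_⟩, fun x hxT hxA => hTS.2 rfl⟩
    · exact (hΦG _).1 ((hG ⟨x, hTS.1 hx⟩).1 hx)
    · rintro ⟨hx, h⟩
      exact (hG ⟨x, hx⟩).2 ((hΦG _).2 h)
  · rintro ⟨Φ, hΦ, hΦs, hdom, hval⟩
    have hTdense : Dense (T.domain : Set V) := hdense.mono hST.1
    have hTS : T ≤ S.adjoint :=
      ⟨fun x hx => ((hdom x).1 hx).1, fun x y hxy => by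
        obtain ⟨x, hx⟩ := x
        obtain ⟨y, hy⟩ := y
        obtain rfl : x = y := hxy
        exact hval x hx hy⟩
    have hmem := mem_adjoint_domain_iff_of_boundary_form hdense hTdense hST hTS hform
    have hT (w : S.adjoint.domain) : (w : V) ∈ T.domain ↔ Φ (Γp w) = Γm w :=
      (hdom w).trans ⟨fun h => h.2, fun h => ⟨w.2, h⟩⟩
    have hinner (x y) : ⟪Φ x, Φ y⟫_ℂ = ⟪x, y⟫_ℂ := LinearIsometry.inner_map_map ⟨Φ, hΦ⟩ x y
    have hdomain (w : S.adjoint.domain) : (w : V) ∈ T.adjoint.domain ↔ (w : V) ∈ T.domain := by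
      rw [hmem, hT]
      constructor
      · intro h
        obtain ⟨z, hz⟩ := hΦs (Γm w)
        rw [← hz]
        congr 1
        refine ext_inner_right ℂ fun x => ?_
        obtain ⟨v, hvm, rfl⟩ := hjoint (Φ x) x
        rw [h v ((hT v).2 hvm.symm), ← hz, hvm, hinner]
      · intro h v hv
        rw [← h, ← (hT v).1 hv, hinner]
    have hTadj : T.adjoint ≤ S.adjoint := adjoint_le_adjoint hdense hST
    have hle : T.domain ≤ T.adjoint.domain := fun x hx => (hdomain ⟨x, hTS.1 hx⟩).2 hx
    refine ⟨hTdense, LinearPMap.ext (Submodule.ext fun x =>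
      ⟨fun hx => (hdomain ⟨x, hTadj.1 hx⟩).1 hx, fun hx => hle hx⟩) fun x hx hx' => ?_⟩
    exact (hTadj.2 (y := ⟨x, hTS.1 hx'⟩) rfl).trans (hTS.2 rfl).symm
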